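/- Let d ≥ 1, m ≥ -d, σ ∈ (0,1), and let L = -Δ + |x|² + m be the Hermite-type operator on ℝ^d. Suppose f : ℝ^d → ℝ is measurable, f ∈ L¹(Φ_σ), and f is strictly 2σ-smooth at a point x₀ ∈ ℝ^d. Then ∫₀^∞ | ∫_{ℝ^d} h_t(x₀,y) f(y) dy − f(x₀) | t^{-(1+σ)} dt < ∞; in particular the Bochner-type integral L^σ f(x₀) = (1/Γ(-σ)) ∫₀^∞ ( e^{-tL}f(x₀) − f(x₀) ) t^{-(1+σ)} dt, with Γ(-σ) := Γ(1-σ)/(-σ), converges absolutely. -/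

import Mathlib

open MeasureTheory Set Filter
open RealInnerProductSpace

/-- The Mehler heat kernel of the Hermite-type operator `L = -Δ + |x|² + m` on `ℝ^d`. -/
noncomputable def mehler (d : ℕ) (m : ℝ) (t : ℝ)
    (x y : EuclideanSpace ℝ (Fin d)) : ℝ :=
  Real.exp (-t * m) * (2 * Real.pi * Real.sinh (2 * t)) ^ (-(d : ℝ) / 2) *
    Real.exp (-‖x - y‖ ^ 2 / (2 * Real.tanh (2 * t)) - Real.tanh t * ⟪x, y⟫)

/-- The weight `Φ_σ` associated with `L = -Δ + |x|² + m`. -/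
noncomputable def PhiSigma (d : ℕ) (m σ : ℝ) (y : EuclideanSpace ℝ (Fin d)) : ℝ :=
  if m = -(d : ℝ) then
    Real.exp (-‖y‖ ^ 2 / 2) / Real.log (Real.exp 1 + ‖y‖) ^ σ
  else
    Real.exp (-‖y‖ ^ 2 / 2) /
      ((1 + ‖y‖) ^ (((d : ℝ) + m) / 2) * Real.log (Real.exp 1 + ‖y‖) ^ (1 + σ))

/-- `f` is `α`-smooth at `x₀` (`f ∈ D^α(x₀)`). -/
def DalphaAt (d : ℕ) (α : ℝ) (f : EuclideanSpace ℝ (Fin d) → ℝ)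
    (x₀ : EuclideanSpace ℝ (Fin d)) : Prop :=
  ∃ δ > (0 : ℝ), MeasureTheory.IntegrableOn
    (fun h => |f (x₀ + h) + f (x₀ - h) - 2 * f x₀| / ‖h‖ ^ ((d : ℝ) + α))
    {h : EuclideanSpace ℝ (Fin d) | ‖h‖ ≤ δ}

/-- `f` is strictly `α`-smooth at `x₀` (`f ∈ D^α_st(x₀)`). -/
def DalphaStAt (d : ℕ) (α : ℝ) (f : EuclideanSpace ℝ (Fin d) → ℝ)
    (x₀ : EuclideanSpace ℝ (Fin d)) : Prop :=
  DalphaAt d α f x₀ ∧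
  ∃ δ > (0 : ℝ), MeasureTheory.IntegrableOn
    (fun h => |f (x₀ + h) - f (x₀ - h)| / ‖h‖ ^ max ((d : ℝ) + α - 3) 0)
    {h : EuclideanSpace ℝ (Fin d) | ‖h‖ ≤ δ}

theorem Real.tanh_le_self {t : ℝ} (ht : 0 ≤ t) : Real.tanh t ≤ t := by
  have hmono : MonotoneOn (fun s : ℝ => s * Real.cosh s - Real.sinh s) (Ici 0) := by
    refine monotoneOn_of_deriv_nonneg (convex_Ici 0) (by fun_prop) (by fun_prop) fun s hs => ?_
    rw [interior_Ici] at hs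
    have hd : HasDerivAt (fun s : ℝ => s * Real.cosh s - Real.sinh s)
        (1 * Real.cosh s + s * Real.sinh s - Real.cosh s) s :=
      ((hasDerivAt_id s).mul (Real.hasDerivAt_cosh s)).sub (Real.hasDerivAt_sinh s)
    rw [hd.deriv]
    have : 0 ≤ s * Real.sinh s := mul_nonneg hs.le (Real.sinh_nonneg_iff.2 hs.le)
    linarith
  have h := hmono self_mem_Ici ht ht
  simp only [zero_mul, Real.sinh_zero, sub_zero] at h
  rw [Real.tanh_eq_sinh_div_cosh, div_le_iff₀ (Real.cosh_pos t)]
  linarith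

theorem Real.tanh_pos {t : ℝ} (ht : 0 < t) : 0 < Real.tanh t := by
  rw [Real.tanh_eq_sinh_div_cosh]
  exact div_pos (Real.sinh_pos_iff.2 ht) (Real.cosh_pos t)

theorem Real.abs_exp_sub_exp_le (a b : ℝ) :
    |Real.exp a - Real.exp b| ≤ |a - b| * Real.exp (max |a| |b|) := by
  wlog hab : b ≤ a generalizing a b
  · simpa [abs_sub_comm, max_comm] using this b a (le_of_not_ge hab)
  have h1 : Real.exp a - Real.exp b ≤ (a - b) * Real.exp a := by
    have h := mul_le_mul_of_nonneg_left (Real.add_one_le_exp (b - a)) (Real.exp_pos a).le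
    rw [← Real.exp_add, add_sub_cancel] at h
    linarith
  rw [abs_of_nonneg (sub_nonneg.2 (Real.exp_le_exp.2 hab)), abs_of_nonneg (sub_nonneg.2 hab)]
  refine h1.trans (mul_le_mul_of_nonneg_left ?_ (sub_nonneg.2 hab))
  exact Real.exp_le_exp.2 ((le_abs_self a).trans (le_max_left _ _))

/-- `∫₀^∞ t^{-a} e^{-b/t} dt = Γ(a-1) b^{1-a}`. -/
theorem integral_rpow_neg_mul_exp_neg_div {a b : ℝ} (ha : 1 < a) (hb : 0 < b) :
    ∫ t in Ioi (0 : ℝ), t ^ (-a) * Real.exp (-(b / t)) = Real.Gamma (a - 1) * b ^ (1 - a) := by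
  have h := integral_comp_rpow_Ioi
    (fun u : ℝ => u ^ ((a - 1) - 1) * Real.exp (-(b * u))) (p := -1) (by norm_num)
  rw [Real.integral_rpow_mul_exp_neg_mul_Ioi (by linarith) hb] at h
  rw [← neg_sub a 1, Real.rpow_neg hb.le, mul_comm, ← Real.inv_rpow hb.le, ← one_div, ← h]
  refine setIntegral_congr_fun measurableSet_Ioi fun t ht => ?_
  have ht : 0 < t := ht
  simp only [smul_eq_mul, abs_neg, abs_one, one_mul, Real.rpow_neg_one, Real.inv_rpow ht.le]
  rw [← Real.rpow_neg ht.le, ← mul_assoc, ← Real.rpow_add ht, ← div_eq_mul_inv]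
  congr 2; ring

theorem lintegral_rpow_neg_mul_exp_neg_div {a b : ℝ} (ha : 1 < a) (hb : 0 < b) :
    ∫⁻ t in Ioi (0 : ℝ), ENNReal.ofReal (t ^ (-a) * Real.exp (-(b / t))) =
      ENNReal.ofReal (Real.Gamma (a - 1) * b ^ (1 - a)) := by
  have hint := integral_rpow_neg_mul_exp_neg_div ha hb
  rw [← hint, ofReal_integral_eq_lintegral_ofReal]
  · refine Integrable.of_integral_ne_zero ?_
    rw [hint]
    exact (mul_pos (Real.Gamma_pos_of_pos (by linarith)) (Real.rpow_pos_of_pos hb _)).ne'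
  · filter_upwards [ae_restrict_mem measurableSet_Ioi] with t ht
    have ht : 0 < t := ht
    positivity

/-- Tonelli's theorem, packaged for kernels whose integral in the first variable is controlled
by a weight against which `g` is integrable. -/
theorem integrable_prod_kernel_mul {α β : Type*} [MeasurableSpace α] [MeasurableSpace β]
    {μ : Measure α} {ν : Measure β} [SFinite μ] [SFinite ν] {K : α → β → ℝ} {g w : β → ℝ}
    (hK : Measurable (Function.uncurry K)) (hg : Measurable g)
    (hw : ∀ᵐ y ∂ν, g y ≠ 0 → ∫⁻ t, ‖K t y‖ₑ ∂μ ≤ ENNReal.ofReal (w y))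
    (hint : Integrable (fun y => g y * w y) ν) :
    Integrable (fun p : α × β => K p.1 p.2 * g p.2) (μ.prod ν) := by
  have hmeas : Measurable (fun p : α × β => K p.1 p.2 * g p.2) :=
    hK.mul (hg.comp measurable_snd)
  refine ⟨hmeas.aestronglyMeasurable, ?_⟩
  rw [HasFiniteIntegral, lintegral_prod_symm' _ hmeas.enorm]
  refine lt_of_le_of_lt (lintegral_mono_ae ?_) hint.2
  filter_upwards [hw] with y hy
  have hKy : Measurable fun t => ‖K t y‖ₑ := (hK.comp measurable_prodMk_right).enorm
  simp only [enorm_mul]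
  rw [lintegral_mul_const _ hKy]
  by_cases h0 : g y = 0
  · simp [h0]
  rw [mul_comm]
  gcongr
  exact (hy h0).trans (Real.ofReal_le_enorm (w y))

theorem exists_one_add_pow_le_mul_exp (n : ℕ) {κ : ℝ} (hκ : 0 < κ) :
    ∃ C : ℝ, 0 < C ∧ ∀ v : ℝ, 0 ≤ v → (1 + 8 * v) ^ n ≤ C * Real.exp (κ * v) := by
  rcases Nat.eq_zero_or_pos n with rfl | hn
  · exact ⟨1, one_pos, fun v hv => by simpa using mul_nonneg hκ.le hv⟩
  have hn' : (0 : ℝ) < n := by exact_mod_cast hn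
  refine ⟨(1 + 8 * n / κ) ^ n, by positivity, fun v hv => ?_⟩
  have hq : 0 < κ / n := by positivity
  have h1 : 1 + 8 * v ≤ (1 + 8 * n / κ) * Real.exp (κ / n * v) := by
    have h2 : 1 ≤ Real.exp (κ / n * v) := Real.one_le_exp (by positivity)
    have h3 : κ / n * v ≤ Real.exp (κ / n * v) := by
      linarith [Real.add_one_le_exp (κ / n * v)]
    have h4 : 8 * v = 8 * n / κ * (κ / n * v) := by field_simp
    have h5 := mul_le_mul_of_nonneg_left h3 (show 0 ≤ 8 * n / κ by positivity)
    rw [h4]; linarith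
  calc (1 + 8 * v) ^ n ≤ ((1 + 8 * n / κ) * Real.exp (κ / n * v)) ^ n := by gcongr
    _ = _ := by
      rw [mul_pow, ← Real.exp_nat_mul]
      congr 2; field_simp

theorem exists_exp_neg_exp_le (p : ℝ) :
    ∃ C : ℝ, 1 ≤ C ∧ ∀ v : ℝ, 0 ≤ v →
      Real.exp (-(Real.exp (4 * v) / 4)) ≤ C * Real.exp (-(p * v)) := by
  obtain ⟨n, hn⟩ := exists_nat_ge p
  refine ⟨4 ^ n * n.factorial, ?_, fun v hv => ?_⟩
  · exact one_le_mul_of_one_le_of_one_le (one_le_pow₀ (by norm_num))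
      (by exact_mod_cast n.factorial_pos)
  have h := Real.pow_div_factorial_le_exp (x := Real.exp (4 * v) / 4) (by positivity) n
  rw [div_pow, div_div, div_le_iff₀ (by positivity)] at h
  have h2 : Real.exp (p * v) ≤ Real.exp (4 * v) ^ n := by
    rw [← Real.exp_nat_mul, Real.exp_le_exp]
    nlinarith [(Nat.cast_nonneg n : (0 : ℝ) ≤ n)]
  rw [Real.exp_neg, Real.exp_neg, ← div_eq_mul_inv, ← one_div,
    div_le_div_iff₀ (Real.exp_pos _) (Real.exp_pos _)]
  linarith

theorem rpow_neg_le_of_shift {σ t l : ℝ} (hσ : σ ∈ Ioo (0 : ℝ) 1) (ht : 1 / 8 < t) (hl : 1 ≤ l) :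
    t ^ (-(1 + σ)) ≤ 4 * (1 + 8 * |t - l / 2|) ^ 2 * l ^ (-(1 + σ)) := by
  have ht0 : 0 < t := by linarith
  have hl0 : 0 < l := by linarith
  set a := 2 * (1 + 8 * |t - l / 2|) with ha
  have ha1 : 1 ≤ a := by have := abs_nonneg (t - l / 2); linarith
  have h1 : l ≤ a * t := by
    have h2 := neg_abs_le (t - l / 2)
    nlinarith [abs_nonneg (t - l / 2)]
  calc t ^ (-(1 + σ)) ≤ (l / a) ^ (-(1 + σ)) := by
        refine Real.rpow_le_rpow_of_nonpos (by positivity) ?_ (by linarith [hσ.1])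
        rw [div_le_iff₀ (by linarith)]; linarith
    _ = a ^ (1 + σ) * l ^ (-(1 + σ)) := by
        rw [Real.div_rpow hl0.le (by linarith), Real.rpow_neg (by linarith : (0 : ℝ) ≤ a),
          div_inv_eq_mul, mul_comm]
    _ ≤ a ^ (2 : ℝ) * l ^ (-(1 + σ)) := by
        gcongr
        linarith [hσ.2]
    _ = _ := by rw [Real.rpow_two, ha]; ring

theorem exists_exp_mul_exp_neg_exp_mul_rpow_le {σ k : ℝ} (hσ : σ ∈ Ioo (0 : ℝ) 1) (hk : 0 < k) :
    ∃ C : ℝ, 0 ≤ C ∧ ∀ l t : ℝ, 1 ≤ l → 1 / 8 < t →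
      Real.exp (-(k * t)) * Real.exp (-(Real.exp (2 * l - 4 * t) / 4)) * t ^ (-(1 + σ)) ≤
        C * (Real.exp (-(k * l / 2)) * l ^ (-(1 + σ))) * (1 + (t - l / 2) ^ 2)⁻¹ := by
  obtain ⟨A, hA, hA'⟩ := exists_one_add_pow_le_mul_exp 4 hk
  obtain ⟨B, hB, hB'⟩ := exists_exp_neg_exp_le (2 * k)
  refine ⟨4 * A * B, by positivity, fun l t hl ht => ?_⟩
  have hB0 : 0 < B := by linarith
  have hl0 : 0 < l := by linarith
  set u := t - l / 2 with hu
  have h1 : Real.exp (-(k * t)) * Real.exp (-(Real.exp (2 * l - 4 * t) / 4)) ≤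
      B * Real.exp (-(k * l / 2)) * Real.exp (-(k * |u|)) := by
    have e1 : 2 * l - 4 * t = 4 * (-u) := by rw [hu]; ring
    have e2 : -(k * t) = -(k * l / 2) + -(k * u) := by rw [hu]; ring
    rw [e1, e2, Real.exp_add]
    rcases le_total 0 u with h0 | h0
    · rw [abs_of_nonneg h0]
      have : Real.exp (-(Real.exp (4 * -u) / 4)) ≤ B :=
        (Real.exp_le_one_iff.2 (by have := Real.exp_pos (4 * -u); linarith)).trans hB
      calc _ ≤ Real.exp (-(k * l / 2)) * Real.exp (-(k * u)) * B := by gcongr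
        _ = _ := by ring
    · rw [abs_of_nonpos h0]
      have h3 := hB' (-u) (by linarith)
      calc _ ≤ Real.exp (-(k * l / 2)) * Real.exp (-(k * u)) *
              (B * Real.exp (-(2 * k * -u))) := by gcongr
        _ = B * Real.exp (-(k * l / 2)) * (Real.exp (-(k * u)) * Real.exp (-(2 * k * -u))) := by
            ring
        _ = _ := by rw [← Real.exp_add]; congr 2; ring
  have h2 := rpow_neg_le_of_shift hσ ht hl
  have h3 := hA' |u| (abs_nonneg u)
  have h4 : Real.exp (-(k * |u|)) * (1 + 8 * |u|) ^ 2 ≤ A * (1 + u ^ 2)⁻¹ := by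
    rw [Real.exp_neg, ← div_eq_inv_mul, ← div_eq_mul_inv,
      div_le_div_iff₀ (Real.exp_pos _) (by positivity)]
    refine le_trans ?_ h3
    have : 1 + u ^ 2 ≤ (1 + 8 * |u|) ^ 2 := by nlinarith [abs_nonneg u, sq_abs u]
    calc _ ≤ (1 + 8 * |u|) ^ 2 * (1 + 8 * |u|) ^ 2 := by gcongr
      _ = _ := by ring
  calc _ ≤ (B * Real.exp (-(k * l / 2)) * Real.exp (-(k * |u|))) *
        (4 * (1 + 8 * |u|) ^ 2 * l ^ (-(1 + σ))) := by
        gcongr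
    _ = 4 * B * (Real.exp (-(k * l / 2)) * l ^ (-(1 + σ))) *
        (Real.exp (-(k * |u|)) * (1 + 8 * |u|) ^ 2) := by ring
    _ ≤ 4 * B * (Real.exp (-(k * l / 2)) * l ^ (-(1 + σ))) * (A * (1 + u ^ 2)⁻¹) := by
        gcongr
    _ = _ := by ring

theorem exists_exp_neg_exp_mul_rpow_le {σ : ℝ} (hσ : σ ∈ Ioo (0 : ℝ) 1) :
    ∃ C : ℝ, 0 ≤ C ∧ ∀ l t : ℝ, 1 ≤ l → 1 / 8 < t → t ≤ l / 2 →
      Real.exp (-(Real.exp (2 * l - 4 * t) / 4)) * t ^ (-(1 + σ)) ≤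
        C * l ^ (-(1 + σ)) * (1 + (t - l / 2) ^ 2)⁻¹ := by
  obtain ⟨C, hC, hC'⟩ := exists_exp_mul_exp_neg_exp_mul_rpow_le hσ one_pos
  refine ⟨C, hC, fun l t hl ht htl => ?_⟩
  have h := mul_le_mul_of_nonneg_left (hC' l t hl ht) (Real.exp_pos t).le
  have hl0 : 0 < l := by linarith
  have hD : 0 ≤ C * l ^ (-(1 + σ)) * (1 + (t - l / 2) ^ 2)⁻¹ := by positivity
  calc _ = Real.exp t * (Real.exp (-(1 * t)) * Real.exp (-(Real.exp (2 * l - 4 * t) / 4)) *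
        t ^ (-(1 + σ))) := by
        rw [← mul_assoc, ← mul_assoc, ← Real.exp_add]; simp
    _ ≤ _ := h
    _ = Real.exp (t - l / 2) * (C * l ^ (-(1 + σ)) * (1 + (t - l / 2) ^ 2)⁻¹) := by
        rw [sub_eq_add_neg, Real.exp_add, one_mul]; ring
    _ ≤ 1 * (C * l ^ (-(1 + σ)) * (1 + (t - l / 2) ^ 2)⁻¹) := by
        gcongr
        exact Real.exp_le_one_iff.2 (by linarith)
    _ = _ := one_mul _

theorem lintegral_inv_one_add_sub_sq (A a : ℝ) (hA : 0 ≤ A) :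
    ∫⁻ t : ℝ, ENNReal.ofReal (A * (1 + (t - a) ^ 2)⁻¹) = ENNReal.ofReal (A * Real.pi) := by
  rw [lintegral_sub_right_eq_self (fun t => ENNReal.ofReal (A * (1 + t ^ 2)⁻¹)) a,
    ← ofReal_integral_eq_lintegral_ofReal (integrable_inv_one_add_sq.const_mul A)
      (Eventually.of_forall fun t => by positivity), integral_const_mul,
    integral_univ_inv_one_add_sq]

theorem exists_lintegral_exp_mul_exp_neg_exp_le {σ k : ℝ} (hσ : σ ∈ Ioo (0 : ℝ) 1) (hk : 0 < k) :
    ∃ C : ℝ, 0 ≤ C ∧ ∀ l : ℝ, 1 ≤ l →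
      ∫⁻ t in Ioi (1 / 8 : ℝ), ENNReal.ofReal (Real.exp (-(k * t)) *
          Real.exp (-(Real.exp (2 * l - 4 * t) / 4)) * t ^ (-(1 + σ))) ≤
        ENNReal.ofReal (C * (Real.exp (-(k * l / 2)) * l ^ (-(1 + σ)))) := by
  obtain ⟨C, hC, hC'⟩ := exists_exp_mul_exp_neg_exp_mul_rpow_le hσ hk
  refine ⟨C * Real.pi, by positivity, fun l hl => ?_⟩
  have hl0 : 0 < l := by linarith
  calc _ ≤ ∫⁻ t in Ioi (1 / 8 : ℝ), ENNReal.ofReal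
        (C * (Real.exp (-(k * l / 2)) * l ^ (-(1 + σ))) * (1 + (t - l / 2) ^ 2)⁻¹) :=
        setLIntegral_mono' measurableSet_Ioi fun t ht =>
          ENNReal.ofReal_le_ofReal (hC' l t hl ht)
    _ ≤ _ := setLIntegral_le_lintegral _ _
    _ = _ := lintegral_inv_one_add_sub_sq _ _ (by positivity)
    _ = _ := by congr 1; ring

theorem exists_lintegral_exp_neg_exp_le {σ : ℝ} (hσ : σ ∈ Ioo (0 : ℝ) 1) :
    ∃ C : ℝ, 0 ≤ C ∧ ∀ l : ℝ, 1 ≤ l →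
      ∫⁻ t in Ioi (1 / 8 : ℝ), ENNReal.ofReal (
          Real.exp (-(Real.exp (2 * l - 4 * t) / 4)) * t ^ (-(1 + σ))) ≤
        ENNReal.ofReal (C * l ^ (-σ)) := by
  obtain ⟨C, hC, hC'⟩ := exists_exp_neg_exp_mul_rpow_le hσ
  have hσ0 := hσ.1
  refine ⟨C * Real.pi + 2 ^ σ / σ, by positivity, fun l hl => ?_⟩
  have hl0 : 0 < l := by linarith
  have hl2 : 0 < l / 2 := by linarith
  have h1 : ∫⁻ t in Ioc (1 / 8 : ℝ) (l / 2), ENNReal.ofReal (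
      Real.exp (-(Real.exp (2 * l - 4 * t) / 4)) * t ^ (-(1 + σ))) ≤
      ENNReal.ofReal (C * Real.pi * l ^ (-σ)) := by
    calc _ ≤ ∫⁻ t in Ioc (1 / 8 : ℝ) (l / 2), ENNReal.ofReal
          (C * l ^ (-(1 + σ)) * (1 + (t - l / 2) ^ 2)⁻¹) :=
          setLIntegral_mono' measurableSet_Ioc fun t ht =>
            ENNReal.ofReal_le_ofReal (hC' l t hl ht.1 ht.2)
      _ ≤ _ := setLIntegral_le_lintegral _ _
      _ = _ := lintegral_inv_one_add_sub_sq _ _ (by positivity)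
      _ ≤ _ := by
        refine ENNReal.ofReal_le_ofReal ?_
        have : l ^ (-(1 + σ)) ≤ l ^ (-σ) := Real.rpow_le_rpow_of_exponent_le hl (by linarith)
        calc _ = C * Real.pi * l ^ (-(1 + σ)) := by ring
          _ ≤ _ := by gcongr
  have h2 : ∫⁻ t in Ioi (l / 2), ENNReal.ofReal (
      Real.exp (-(Real.exp (2 * l - 4 * t) / 4)) * t ^ (-(1 + σ))) ≤
      ENNReal.ofReal (2 ^ σ / σ * l ^ (-σ)) := by
    calc _ ≤ ∫⁻ t in Ioi (l / 2), ENNReal.ofReal (t ^ (-(1 + σ))) := by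
          refine setLIntegral_mono' measurableSet_Ioi fun t ht => ENNReal.ofReal_le_ofReal ?_
          have ht : l / 2 < t := ht
          have ht0 : 0 < t := by linarith
          refine mul_le_of_le_one_left (by positivity) (Real.exp_le_one_iff.2 ?_)
          have := Real.exp_pos (2 * l - 4 * t)
          linarith
      _ = ENNReal.ofReal (∫ t in Ioi (l / 2), t ^ (-(1 + σ))) := by
          rw [ofReal_integral_eq_lintegral_ofReal]
          · exact integrableOn_Ioi_rpow_of_lt (by linarith) hl2
          · filter_upwards [ae_restrict_mem measurableSet_Ioi] with t ht
            exact Real.rpow_nonneg (hl2.trans ht).le _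
      _ = _ := by
          rw [integral_Ioi_rpow_of_lt (by linarith) hl2]
          congr 1
          have e : -(1 + σ) + 1 = -σ := by ring
          rw [e, Real.div_rpow hl0.le (by norm_num), Real.rpow_neg (by norm_num : (0:ℝ) ≤ 2)]
          field_simp
  calc _ ≤ ∫⁻ t in Ioc (1 / 8 : ℝ) (l / 2) ∪ Ioi (l / 2), ENNReal.ofReal (
          Real.exp (-(Real.exp (2 * l - 4 * t) / 4)) * t ^ (-(1 + σ))) := by
        refine lintegral_mono_set fun t ht => ?_
        rcases le_or_gt t (l / 2) with h | h
        · exact Or.inl ⟨ht, h⟩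
        · exact Or.inr h
    _ ≤ _ := lintegral_union_le _ _ _
    _ ≤ _ := add_le_add h1 h2
    _ = _ := by
        rw [← ENNReal.ofReal_add (by positivity) (by positivity)]
        congr 1; ring

section MehlerKernel

variable {d : ℕ} {m σ t : ℝ}

theorem measurable_mehler (d : ℕ) (m : ℝ) (x : EuclideanSpace ℝ (Fin d)) :
    Measurable (Function.uncurry fun t y => mehler d m t x y) := by
  simp only [Function.uncurry_def, mehler, Real.tanh_eq_sinh_div_cosh]
  fun_prop

theorem mehler_nonneg (ht : 0 < t) (x y : EuclideanSpace ℝ (Fin d)) : 0 ≤ mehler d m t x y := by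
  have : 0 < Real.sinh (2 * t) := Real.sinh_pos_iff.2 (by linarith)
  have := Real.pi_pos
  unfold mehler
  positivity

theorem mehler_eq (ht : 0 < t) (x y : EuclideanSpace ℝ (Fin d)) :
    mehler d m t x y =
      Real.exp (-t * m) * (2 * Real.pi * Real.sinh (2 * t)) ^ (-(d : ℝ) / 2) *
        Real.exp ((2 * ⟪x, y⟫ - Real.cosh (2 * t) * (‖x‖ ^ 2 + ‖y‖ ^ 2)) /
          (2 * Real.sinh (2 * t))) := by
  unfold mehler
  congr 2
  have hs : 0 < Real.sinh t := Real.sinh_pos_iff.2 ht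
  have hc : 0 < Real.cosh t := Real.cosh_pos t
  have hc2 : 0 < Real.cosh (2 * t) := Real.cosh_pos _
  rw [Real.tanh_eq_sinh_div_cosh, Real.tanh_eq_sinh_div_cosh, norm_sub_sq_real,
    Real.sinh_two_mul]
  have h2 : Real.cosh (2 * t) = 1 + 2 * Real.sinh t ^ 2 := by
    rw [Real.cosh_two_mul, Real.cosh_sq]; ring
  field_simp
  rw [h2]
  ring

theorem mehler_le_of_large (m : ℝ) (ht : 1 / 8 < t)
    (x y : EuclideanSpace ℝ (Fin d)) :
    mehler d m t x y ≤ Real.exp (6 * ‖x‖ ^ 2) * (Real.exp (-‖y‖ ^ 2 / 2) *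
      (Real.exp (-((d + m) * t)) * Real.exp (-(Real.exp (-(4 * t)) * ‖y‖ ^ 2 / 2)))) := by
  have ht0 : 0 < t := by linarith
  set q := Real.exp (-(2 * t)) with hq
  have hq0 : 0 < q := Real.exp_pos _
  have hqi : Real.exp (2 * t) = q⁻¹ := by rw [hq, Real.exp_neg, inv_inv]
  have hq2 : Real.exp (-(4 * t)) = q ^ 2 := by rw [hq, ← Real.exp_nat_mul]; congr 1; push_cast; ring
  have hs : Real.sinh (2 * t) = (q⁻¹ - q) / 2 := by rw [Real.sinh_eq, hqi]
  have hc : Real.cosh (2 * t) = (q⁻¹ + q) / 2 := by rw [Real.cosh_eq, hqi]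
  have hq23 : q ^ 2 ≤ 2 / 3 := by
    rw [← hq2, Real.exp_neg, inv_le_comm₀ (Real.exp_pos _) (by norm_num)]
    have := Real.add_one_le_exp (4 * t)
    linarith
  have hspos : 0 < Real.sinh (2 * t) := Real.sinh_pos_iff.2 (by linarith)
  have hqs : q * Real.sinh (2 * t) = (1 - q ^ 2) / 2 := by
    rw [hs]; field_simp
  have hpre : (2 * Real.pi * Real.sinh (2 * t)) ^ (-(d : ℝ) / 2) ≤ Real.exp (-(d * t)) := by
    have h1 : q⁻¹ ≤ 2 * Real.pi * Real.sinh (2 * t) := by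
      have h2 : 1 ≤ q * (2 * Real.pi * Real.sinh (2 * t)) := by
        have : q * (2 * Real.pi * Real.sinh (2 * t)) = Real.pi * (1 - q ^ 2) := by
          linear_combination 2 * Real.pi * hqs
        rw [this]
        nlinarith [Real.pi_gt_three]
      rw [inv_le_iff_one_le_mul₀ hq0]; linarith
    calc _ ≤ (Real.exp (2 * t)) ^ (-(d : ℝ) / 2) := by
          rw [hqi]
          exact Real.rpow_le_rpow_of_nonpos (by positivity) h1
            (by have : (0 : ℝ) ≤ d := Nat.cast_nonneg d
                linarith)
      _ = _ := by rw [← Real.exp_mul]; congr 1; ring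
  have hexp : (2 * ⟪x, y⟫ - Real.cosh (2 * t) * (‖x‖ ^ 2 + ‖y‖ ^ 2)) / (2 * Real.sinh (2 * t)) ≤
      6 * ‖x‖ ^ 2 + (-‖y‖ ^ 2 / 2 + -(Real.exp (-(4 * t)) * ‖y‖ ^ 2 / 2)) := by
    rw [div_le_iff₀ (by positivity), hq2]
    have hi := real_inner_le_norm x y
    set X := ‖x‖
    set r := ‖y‖
    have hX : 2 * X * r ≤ q * r ^ 2 / 2 + 2 * X ^ 2 * q⁻¹ := by
      have := sq_nonneg (q * r - 2 * X)
      have e : q * r ^ 2 / 2 + 2 * X ^ 2 * q⁻¹ - 2 * X * r = (q * r - 2 * X) ^ 2 * q⁻¹ / 2 := by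
        field_simp; ring
      have : 0 ≤ (q * r - 2 * X) ^ 2 * q⁻¹ / 2 := by positivity
      linarith
    have hcs : Real.cosh (2 * t) = Real.sinh (2 * t) + q := by rw [hs, hc]; ring
    have hqs' : q ^ 2 * r ^ 2 * Real.sinh (2 * t) ≤ q * r ^ 2 / 2 := by
      have e : q ^ 2 * r ^ 2 * Real.sinh (2 * t) = q * r ^ 2 * ((1 - q ^ 2) / 2) := by
        rw [← hqs]; ring
      rw [e]
      have : 0 ≤ q * r ^ 2 := by positivity
      nlinarith [sq_nonneg q]
    have hXs : 2 * X ^ 2 * q⁻¹ ≤ 12 * X ^ 2 * Real.sinh (2 * t) := by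
      have h6 : q⁻¹ ≤ 6 * Real.sinh (2 * t) := by
        rw [inv_le_iff_one_le_mul₀ hq0]
        nlinarith
      nlinarith [sq_nonneg X]
    have hcX : 0 ≤ Real.cosh (2 * t) * X ^ 2 := mul_nonneg (Real.cosh_pos _).le (sq_nonneg _)
    rw [hcs] at hcX ⊢
    nlinarith
  rw [mehler_eq ht0]
  calc _ ≤ Real.exp (-t * m) * Real.exp (-(d * t)) * Real.exp
        (6 * ‖x‖ ^ 2 + (-‖y‖ ^ 2 / 2 + -(Real.exp (-(4 * t)) * ‖y‖ ^ 2 / 2))) := by gcongr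
    _ = _ := by
      simp only [← Real.exp_add]
      congr 1; ring

theorem exists_mehler_le (m : ℝ) (ht : 0 < t) (x : EuclideanSpace ℝ (Fin d)) :
    ∃ C : ℝ, 0 ≤ C ∧ ∀ y, mehler d m t x y ≤ C * Real.exp (-‖y‖ ^ 2 / 2 - ‖y‖) := by
  have hs : 0 < Real.sinh (2 * t) := Real.sinh_pos_iff.2 (by linarith)
  have hcs := Real.sinh_lt_cosh (2 * t)
  set s := Real.sinh (2 * t) with hsdef
  set c := Real.cosh (2 * t)
  have hP : 0 ≤ Real.exp (-t * m) * (2 * Real.pi * s) ^ (-(d : ℝ) / 2) := by positivity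
  refine ⟨Real.exp (-t * m) * (2 * Real.pi * s) ^ (-(d : ℝ) / 2) *
    Real.exp ((‖x‖ + s) ^ 2 / (2 * s * (c - s))), by positivity, fun y => ?_⟩
  rw [mehler_eq ht, mul_assoc _ (Real.exp _) (Real.exp _), ← Real.exp_add]
  refine mul_le_mul_of_nonneg_left (Real.exp_le_exp.2 ?_) hP
  have hcs' : 0 < c - s := by linarith
  have hi := real_inner_le_norm x y
  have e : (‖x‖ + s) ^ 2 / (2 * s * (c - s)) + (-‖y‖ ^ 2 / 2 - ‖y‖) -
      (2 * (‖x‖ * ‖y‖) - c * ‖y‖ ^ 2) / (2 * s) =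
      ((c - s) * ‖y‖ - (‖x‖ + s)) ^ 2 / (2 * s * (c - s)) := by
    field_simp; ring
  have h1 : 0 ≤ ((c - s) * ‖y‖ - (‖x‖ + s)) ^ 2 / (2 * s * (c - s)) := by positivity
  have h2 : (2 * ⟪x, y⟫ - c * (‖x‖ ^ 2 + ‖y‖ ^ 2)) / (2 * s) ≤
      (2 * (‖x‖ * ‖y‖) - c * ‖y‖ ^ 2) / (2 * s) := by
    gcongr
    nlinarith [mul_nonneg (Real.cosh_pos (2 * t)).le (sq_nonneg ‖x‖)]
  linarith

theorem exists_mul_exp_le_PhiSigma (m : ℝ) (hσ : σ ∈ Ioo (0 : ℝ) 1) :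
    ∃ c : ℝ, 0 < c ∧ ∀ y : EuclideanSpace ℝ (Fin d),
      c * Real.exp (-‖y‖ ^ 2 / 2 - ‖y‖) ≤ PhiSigma d m σ y := by
  obtain ⟨n, hn⟩ := exists_nat_ge ((d + m) / 2)
  obtain ⟨C, hC, hC'⟩ := exists_one_add_pow_le_mul_exp (n + 2) one_pos
  have he := Real.exp_one_lt_d9
  have he2 := Real.add_one_le_exp (1 : ℝ)
  refine ⟨(9 * C)⁻¹, by positivity, fun y => ?_⟩
  set r := ‖y‖ with hr
  have hr0 : 0 ≤ r := norm_nonneg y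
  have hC1 := hC' r hr0
  rw [one_mul] at hC1
  have hlog1 : 1 ≤ Real.log (Real.exp 1 + r) := by
    rw [Real.le_log_iff_exp_le (by positivity)]; linarith
  have hlog2 : Real.log (Real.exp 1 + r) ≤ 3 * (1 + r) := by
    have := Real.log_le_sub_one_of_pos (show 0 < Real.exp 1 + r by positivity)
    linarith
  have hlogp : ∀ a : ℝ, a ≤ 2 → Real.log (Real.exp 1 + r) ^ a ≤ 9 * (1 + r) ^ 2 := fun a ha => by
    calc _ ≤ Real.log (Real.exp 1 + r) ^ (2 : ℝ) :=
          Real.rpow_le_rpow_of_exponent_le hlog1 ha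
      _ ≤ (3 * (1 + r)) ^ (2 : ℝ) := by gcongr
      _ = _ := by rw [Real.rpow_two]; ring
  have hpow : ∀ k ≤ n + 2, (1 + r) ^ k ≤ C * Real.exp r := fun k hk => by
    calc (1 + r) ^ k ≤ (1 + r) ^ (n + 2) := pow_le_pow_right₀ (by linarith) hk
      _ ≤ (1 + 8 * r) ^ (n + 2) := by gcongr; linarith
      _ ≤ _ := hC1
  rw [Real.exp_sub, mul_div_assoc', inv_mul_eq_div, div_div]
  unfold PhiSigma
  have hlog0 : 0 < Real.log (Real.exp 1 + r) := by linarith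
  split_ifs
  · refine div_le_div_of_nonneg_left (Real.exp_pos _).le (by positivity) ?_
    calc _ ≤ 9 * (1 + r) ^ 2 := hlogp σ (by linarith [hσ.2])
      _ ≤ 9 * (C * Real.exp r) := by gcongr; exact hpow 2 (by omega)
      _ = _ := by ring
  · refine div_le_div_of_nonneg_left (Real.exp_pos _).le (by positivity) ?_
    calc _ ≤ (1 + r) ^ (n : ℝ) * (9 * (1 + r) ^ 2) := by
          gcongr
          · linarith
          · exact hlogp _ (by linarith [hσ.2])
      _ = 9 * (1 + r) ^ (n + 2) := by rw [Real.rpow_natCast]; ring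
      _ ≤ 9 * (C * Real.exp r) := by gcongr; exact hpow _ le_rfl
      _ = _ := by ring

theorem exists_lintegral_mehler_le (hm : -(d : ℝ) ≤ m) (hσ : σ ∈ Ioo (0 : ℝ) 1)
    (x : EuclideanSpace ℝ (Fin d)) :
    ∃ C : ℝ, 0 ≤ C ∧ ∀ y, ∫⁻ t in Ioi (1 / 8 : ℝ), ‖mehler d m t x y * t ^ (-(1 + σ))‖ₑ ≤
      ENNReal.ofReal (C * PhiSigma d m σ y) := by
  have he := Real.exp_one_lt_d9
  -- the logarithmic scale `l = log (e + ‖y‖)`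
  have key : ∀ y : EuclideanSpace ℝ (Fin d), ∀ t : ℝ, 1 / 8 < t →
      ‖mehler d m t x y * t ^ (-(1 + σ))‖ₑ ≤
        ENNReal.ofReal (Real.exp (6 * ‖x‖ ^ 2 + 4) * Real.exp (-‖y‖ ^ 2 / 2)) *
        ENNReal.ofReal (Real.exp (-((d + m) * t)) *
          Real.exp (-(Real.exp (2 * Real.log (Real.exp 1 + ‖y‖) - 4 * t) / 4)) *
          t ^ (-(1 + σ))) := fun y t ht => by
    have ht0 : 0 < t := by linarith
    have hR : 0 < Real.exp 1 + ‖y‖ := by positivity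
    rw [Real.enorm_of_nonneg (mul_nonneg (mehler_nonneg ht0 x y) (Real.rpow_nonneg ht0.le _)),
      ← ENNReal.ofReal_mul (by positivity)]
    refine ENNReal.ofReal_le_ofReal ?_
    have h1 := mehler_le_of_large m ht x y
    have h2 : Real.exp (-(Real.exp (-(4 * t)) * ‖y‖ ^ 2 / 2)) ≤
        Real.exp 4 * Real.exp (-(Real.exp (2 * Real.log (Real.exp 1 + ‖y‖) - 4 * t) / 4)) := by
      rw [← Real.exp_add, Real.exp_le_exp, sub_eq_add_neg, Real.exp_add (2 * _), mul_comm 2,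
        Real.exp_mul, Real.exp_log hR, Real.rpow_two]
      have h3 : Real.exp (-(4 * t)) ≤ 1 := Real.exp_le_one_iff.2 (by linarith)
      have h4 : (Real.exp 1 + ‖y‖) ^ 2 ≤ 16 + 2 * ‖y‖ ^ 2 := by
        have h5 := sq_nonneg (Real.exp 1 - ‖y‖)
        have h6 : Real.exp 1 ^ 2 ≤ 8 := by nlinarith [Real.exp_pos 1]
        nlinarith
      have h7 := mul_le_mul_of_nonneg_right h4 (Real.exp_pos (-(4 * t))).le
      nlinarith
    calc _ ≤ Real.exp (6 * ‖x‖ ^ 2) * (Real.exp (-‖y‖ ^ 2 / 2) * (Real.exp (-((d + m) * t)) *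
          (Real.exp 4 *
            Real.exp (-(Real.exp (2 * Real.log (Real.exp 1 + ‖y‖) - 4 * t) / 4))))) *
          t ^ (-(1 + σ)) := by
          gcongr
          exact h1.trans (by gcongr)
      _ = _ := by rw [Real.exp_add]; ring
  have key2 := fun y : EuclideanSpace ℝ (Fin d) =>
    (setLIntegral_mono' (μ := volume) measurableSet_Ioi (key y)).trans_eq
      (lintegral_const_mul' _ _ ENNReal.ofReal_ne_top)
  have hl1 : ∀ y : EuclideanSpace ℝ (Fin d), 1 ≤ Real.log (Real.exp 1 + ‖y‖) := fun y => by
    rw [Real.le_log_iff_exp_le (by positivity)]; linarith [norm_nonneg y]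
  unfold PhiSigma
  rcases hm.eq_or_lt with h0 | h0
  · obtain ⟨C, hC, hC'⟩ := exists_lintegral_exp_neg_exp_le hσ
    refine ⟨Real.exp (6 * ‖x‖ ^ 2 + 4) * C, by positivity, fun y => (key2 y).trans ?_⟩
    rw [if_pos h0.symm]
    have h00 : (d : ℝ) + m = 0 := by linarith
    simp only [h00, zero_mul, neg_zero, Real.exp_zero, one_mul]
    have hl0 : 0 ≤ Real.log (Real.exp 1 + ‖y‖) := by linarith [hl1 y]
    calc _ ≤ ENNReal.ofReal (Real.exp (6 * ‖x‖ ^ 2 + 4) * Real.exp (-‖y‖ ^ 2 / 2)) *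
          ENNReal.ofReal (C * Real.log (Real.exp 1 + ‖y‖) ^ (-σ)) := by
          gcongr; exact hC' _ (hl1 y)
      _ = _ := by
        rw [← ENNReal.ofReal_mul (by positivity), Real.rpow_neg hl0]
        congr 1; ring
  · have hk : 0 < (d : ℝ) + m := by linarith
    obtain ⟨C, hC, hC'⟩ := exists_lintegral_exp_mul_exp_neg_exp_le hσ hk
    refine ⟨Real.exp (6 * ‖x‖ ^ 2 + 4) * C, by positivity, fun y => (key2 y).trans ?_⟩
    rw [if_neg h0.ne']
    have hl0 : 0 < Real.log (Real.exp 1 + ‖y‖) := by linarith [hl1 y]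
    have hR : 0 < Real.exp 1 + ‖y‖ := by positivity
    have hpow : Real.exp (-((d + m) * Real.log (Real.exp 1 + ‖y‖) / 2)) ≤
        ((1 + ‖y‖) ^ (((d : ℝ) + m) / 2))⁻¹ := by
      have e : -((d + m) * Real.log (Real.exp 1 + ‖y‖) / 2) =
          Real.log (Real.exp 1 + ‖y‖) * -((d + m) / 2) := by ring
      rw [e, Real.exp_mul, Real.exp_log hR, Real.rpow_neg hR.le]
      gcongr
      exact Real.one_le_exp zero_le_one
    calc _ ≤ ENNReal.ofReal (Real.exp (6 * ‖x‖ ^ 2 + 4) * Real.exp (-‖y‖ ^ 2 / 2)) *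
          ENNReal.ofReal (C * (Real.exp (-((d + m) * Real.log (Real.exp 1 + ‖y‖) / 2)) *
            Real.log (Real.exp 1 + ‖y‖) ^ (-(1 + σ)))) := by
          gcongr; exact hC' _ (hl1 y)
      _ ≤ ENNReal.ofReal (Real.exp (6 * ‖x‖ ^ 2 + 4) * Real.exp (-‖y‖ ^ 2 / 2)) *
          ENNReal.ofReal (C * (((1 + ‖y‖) ^ (((d : ℝ) + m) / 2))⁻¹ *
            Real.log (Real.exp 1 + ‖y‖) ^ (-(1 + σ)))) := by
          gcongr
      _ = _ := by
        rw [← ENNReal.ofReal_mul (by positivity), Real.rpow_neg hl0.le]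
        congr 1
        field_simp

theorem integral_mehler (m : ℝ) (ht : 0 < t) (x : EuclideanSpace ℝ (Fin d)) :
    ∫ y, mehler d m t x y =
      Real.exp (-(t * m) - d / 2 * Real.log (Real.cosh (2 * t)) -
        Real.tanh (2 * t) * ‖x‖ ^ 2 / 2) := by
  have hs : 0 < Real.sinh (2 * t) := Real.sinh_pos_iff.2 (by linarith)
  have hc : 0 < Real.cosh (2 * t) := Real.cosh_pos _
  have hcs := Real.cosh_sq (2 * t)
  rw [Real.tanh_eq_sinh_div_cosh]
  simp only [mehler_eq ht]
  set s := Real.sinh (2 * t)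
  set c := Real.cosh (2 * t)
  have hb : 0 < c / (2 * s) := by positivity
  -- completing the square
  have e : ∀ y : EuclideanSpace ℝ (Fin d),
      (2 * ⟪x, y⟫ - c * (‖x‖ ^ 2 + ‖y‖ ^ 2)) / (2 * s) =
        -(s / c * ‖x‖ ^ 2 / 2) + -(c / (2 * s)) * ‖y - c⁻¹ • x‖ ^ 2 := fun y => by
    rw [norm_sub_sq_real, real_inner_smul_right, norm_smul, Real.norm_of_nonneg (by positivity),
      real_inner_comm]
    field_simp
    linear_combination (-‖x‖ ^ 2) * hcs
  simp only [e, Real.exp_add, integral_const_mul]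
  rw [integral_sub_right_eq_self (fun y : EuclideanSpace ℝ (Fin d) =>
    Real.exp (-(c / (2 * s)) * ‖y‖ ^ 2)), GaussianFourier.integral_rexp_neg_mul_sq_norm hb,
    finrank_euclideanSpace_fin]
  have h1 : (2 * Real.pi * s) ^ (-(d : ℝ) / 2) * (Real.pi / (c / (2 * s))) ^ ((d : ℝ) / 2) =
      Real.exp (-(d / 2 * Real.log c)) := by
    have e2 : Real.pi / (c / (2 * s)) = 2 * Real.pi * s * c⁻¹ := by field_simp
    have hp : 0 < 2 * Real.pi * s := by positivity
    rw [e2, Real.mul_rpow hp.le (by positivity), ← mul_assoc, ← Real.rpow_add hp, neg_div,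
      neg_add_cancel, Real.rpow_zero, one_mul, Real.inv_rpow hc.le, ← Real.rpow_neg hc.le,
      Real.rpow_def_of_pos hc]
    congr 1; ring
  rw [sub_eq_add_neg, sub_eq_add_neg, Real.exp_add, Real.exp_add, ← h1, neg_mul]
  ring

theorem exists_abs_integral_mehler_sub_one_le (m : ℝ) (x : EuclideanSpace ℝ (Fin d)) :
    ∃ C : ℝ, 0 ≤ C ∧ ∀ t ∈ Ioc (0 : ℝ) (1 / 8), |(∫ y, mehler d m t x y) - 1| ≤ C * t := by
  refine ⟨(|m| + d + ‖x‖ ^ 2) * Real.exp (|m| + d + ‖x‖ ^ 2), by positivity, fun t ht => ?_⟩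
  obtain ⟨ht0, ht1⟩ := ht
  rw [integral_mehler m ht0, ← Real.exp_zero]
  set a := -(t * m) - d / 2 * Real.log (Real.cosh (2 * t)) - Real.tanh (2 * t) * ‖x‖ ^ 2 / 2
  have hlog0 : 0 ≤ Real.log (Real.cosh (2 * t)) := Real.log_nonneg (Real.one_le_cosh _)
  have hlog1 : Real.log (Real.cosh (2 * t)) ≤ 2 * t := by
    rw [Real.log_le_iff_le_exp (Real.cosh_pos _)]
    have := Real.cosh_add_sinh (2 * t)
    have := Real.sinh_pos_iff.2 (show 0 < 2 * t by linarith)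
    linarith
  have hth := Real.tanh_le_self (show 0 ≤ 2 * t by linarith)
  have hth0 := Real.tanh_pos (show 0 < 2 * t by linarith)
  have hd : (0 : ℝ) ≤ d := Nat.cast_nonneg d
  have ha : |a| ≤ (|m| + d + ‖x‖ ^ 2) * t := by
    have h1 : |(t * m)| = |m| * t := by rw [abs_mul, abs_of_pos ht0, mul_comm]
    have h2 := neg_abs_le (t * m)
    have h3 := le_abs_self (t * m)
    have h4 : d / 2 * Real.log (Real.cosh (2 * t)) ≤ d * t := by nlinarith
    have h5 : 0 ≤ d / 2 * Real.log (Real.cosh (2 * t)) := by positivity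
    have h6 : Real.tanh (2 * t) * ‖x‖ ^ 2 / 2 ≤ ‖x‖ ^ 2 * t := by nlinarith [sq_nonneg ‖x‖]
    have h7 : 0 ≤ Real.tanh (2 * t) * ‖x‖ ^ 2 / 2 := by positivity
    have h8 : 0 ≤ d * t := by positivity
    have h9 : 0 ≤ ‖x‖ ^ 2 * t := by positivity
    rw [abs_le]
    constructor <;> · simp only [a]; nlinarith
  have hM : 0 ≤ |m| + d + ‖x‖ ^ 2 := by positivity
  have ha' : |a| ≤ |m| + d + ‖x‖ ^ 2 := ha.trans (by nlinarith)
  have h := Real.abs_exp_sub_exp_le a 0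
  rw [sub_zero, abs_zero, max_eq_left (abs_nonneg a)] at h
  calc _ ≤ |a| * Real.exp |a| := h
    _ ≤ (|m| + d + ‖x‖ ^ 2) * t * Real.exp (|m| + d + ‖x‖ ^ 2) := by gcongr
    _ = _ := by ring

/-- The short-time shape of the Mehler kernel: a Gaussian factor `P`, even in `h`, times a
bounded perturbation. -/
theorem exists_mehler_add_eq (m : ℝ) (ht : t ∈ Ioc (0 : ℝ) (1 / 8)) (x : EuclideanSpace ℝ (Fin d)) :
    ∃ P : EuclideanSpace ℝ (Fin d) → ℝ, (∀ h, P (-h) = P h) ∧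
      (∀ h, 0 ≤ P h ∧ P h ≤ Real.exp |m| * (t ^ (-(d : ℝ) / 2) *
        Real.exp (-(‖h‖ ^ 2 / 4 / t)))) ∧
      ∀ h, mehler d m t x (x + h) = P h * Real.exp (-(Real.tanh t * ⟪x, x + h⟫)) := by
  obtain ⟨ht0, ht1⟩ := ht
  have hs : 2 * t < Real.sinh (2 * t) := Real.self_lt_sinh_iff.2 (by linarith)
  have hs0 : 0 < Real.sinh (2 * t) := by linarith
  have hd : (0 : ℝ) ≤ d := Nat.cast_nonneg d
  have hth := Real.tanh_le_self (show 0 ≤ 2 * t by linarith)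
  have hth0 := Real.tanh_pos (show 0 < 2 * t by linarith)
  have hpi := Real.pi_gt_three
  refine ⟨fun h => Real.exp (-t * m) * (2 * Real.pi * Real.sinh (2 * t)) ^ (-(d : ℝ) / 2) *
    Real.exp (-‖h‖ ^ 2 / (2 * Real.tanh (2 * t))), fun h => by simp only [norm_neg],
    fun h => ⟨by positivity, ?_⟩, fun h => ?_⟩
  · have h1 : Real.exp (-t * m) ≤ Real.exp |m| := by
      rw [Real.exp_le_exp]
      nlinarith [neg_abs_le m, abs_nonneg m]
    have h2 : (2 * Real.pi * Real.sinh (2 * t)) ^ (-(d : ℝ) / 2) ≤ t ^ (-(d : ℝ) / 2) :=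
      Real.rpow_le_rpow_of_nonpos ht0 (by nlinarith) (by linarith)
    have h3 : -‖h‖ ^ 2 / (2 * Real.tanh (2 * t)) ≤ -(‖h‖ ^ 2 / 4 / t) := by
      rw [neg_div, neg_le_neg_iff, div_div]
      exact div_le_div_of_nonneg_left (sq_nonneg _) (by positivity) (by linarith)
    rw [← mul_assoc]
    exact mul_le_mul (mul_le_mul h1 h2 (by positivity) (by positivity)) (Real.exp_le_exp.2 h3)
      (by positivity) (by positivity)
  · rw [mehler, sub_add_cancel_left, norm_neg, sub_eq_add_neg, Real.exp_add]
    ring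

theorem exists_abs_mehler_add_add_le (m : ℝ) (x : EuclideanSpace ℝ (Fin d)) (δ : ℝ) :
    ∃ C : ℝ, 0 ≤ C ∧ ∀ t ∈ Ioc (0 : ℝ) (1 / 8), ∀ h : EuclideanSpace ℝ (Fin d), ‖h‖ ≤ δ →
      |mehler d m t x (x + h) + mehler d m t x (x - h)| ≤
        C * (t ^ (-(d : ℝ) / 2) * Real.exp (-(‖h‖ ^ 2 / 4 / t))) ∧
      |mehler d m t x (x + h) - mehler d m t x (x - h)| ≤
        C * (t * ‖h‖ * (t ^ (-(d : ℝ) / 2) * Real.exp (-(‖h‖ ^ 2 / 4 / t)))) := by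
  set M := ‖x‖ * (‖x‖ + δ) with hM
  refine ⟨(2 + 2 * ‖x‖) * Real.exp M * Real.exp |m|, by positivity, fun t ht h hh => ?_⟩
  obtain ⟨P, hPe, hP, hK⟩ := exists_mehler_add_eq m ht x
  obtain ⟨hP0, hP1⟩ := hP h
  have ht0 : 0 < t := ht.1
  have hτ := Real.tanh_le_self ht0.le
  have hτ0 := Real.tanh_pos ht0
  have hτ1 := Real.tanh_lt_one t
  set G := t ^ (-(d : ℝ) / 2) * Real.exp (-(‖h‖ ^ 2 / 4 / t)) with hG
  have hG0 : 0 ≤ G := by positivity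
  have hb : ∀ k : EuclideanSpace ℝ (Fin d), ‖k‖ ≤ δ → |(-(Real.tanh t * ⟪x, x + k⟫))| ≤ M :=
    fun k hk => by
      rw [abs_neg, abs_mul, abs_of_pos hτ0]
      have h1 := abs_real_inner_le_norm x (x + k)
      have h2 : ‖x‖ * ‖x + k‖ ≤ M := by
        rw [hM]; gcongr; exact (norm_add_le x k).trans (by gcongr)
      nlinarith [abs_nonneg ⟪x, x + k⟫]
  have hbp := hb h hh
  have hbm := hb (-h) (by rwa [norm_neg])
  rw [sub_eq_add_neg x h, hK, hK, hPe]
  set a := -(Real.tanh t * ⟪x, x + h⟫) with ha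
  set b := -(Real.tanh t * ⟪x, x + -h⟫) with hb'
  have hab : |a - b| ≤ 2 * (t * (‖x‖ * ‖h‖)) := by
    have e : a - b = -(2 * (Real.tanh t * ⟪x, h⟫)) := by
      rw [ha, hb', inner_add_right, inner_add_right, inner_neg_right]; ring
    rw [e, abs_neg, abs_mul, abs_mul, abs_of_pos hτ0, abs_two]
    gcongr
    exact abs_real_inner_le_norm x h
  constructor
  · rw [abs_of_nonneg (by positivity), ← mul_add]
    have h1 : Real.exp a ≤ Real.exp M := Real.exp_le_exp.2 ((le_abs_self _).trans hbp)
    have h2 : Real.exp b ≤ Real.exp M := Real.exp_le_exp.2 ((le_abs_self _).trans hbm)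
    calc _ ≤ Real.exp |m| * G * (2 * Real.exp M) := by gcongr; linarith
      _ = 2 * (Real.exp M * Real.exp |m| * G) := by ring
      _ ≤ (2 + 2 * ‖x‖) * (Real.exp M * Real.exp |m| * G) := by
        gcongr; linarith [norm_nonneg x]
      _ = _ := by ring
  · rw [← mul_sub, abs_mul, abs_of_nonneg hP0]
    calc _ ≤ Real.exp |m| * G * (2 * (t * (‖x‖ * ‖h‖)) * Real.exp M) := by
          gcongr
          refine (Real.abs_exp_sub_exp_le a b).trans ?_
          gcongr
          exact max_le hbp hbm
      _ = 2 * ‖x‖ * (Real.exp M * Real.exp |m| * (t * ‖h‖ * G)) := by ring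
      _ ≤ (2 + 2 * ‖x‖) * (Real.exp M * Real.exp |m| * (t * ‖h‖ * G)) := by
          gcongr; linarith
      _ = _ := by ring

theorem exists_mehler_add_le_of_far (m : ℝ) (x : EuclideanSpace ℝ (Fin d)) {δ : ℝ} (hδ : 0 < δ) :
    ∃ C : ℝ, 0 ≤ C ∧ ∀ t ∈ Ioc (0 : ℝ) (1 / 8), ∀ h : EuclideanSpace ℝ (Fin d), δ ≤ ‖h‖ →
      mehler d m t x (x + h) ≤ C * Real.exp (-‖x + h‖ ^ 2 / 2 - ‖x + h‖) *
        (t ^ (-(d : ℝ) / 2) * Real.exp (-(δ ^ 2 / 8 / t))) := by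
  refine ⟨Real.exp |m| * Real.exp (3 * ‖x‖ ^ 2 + (‖x‖ + 1) ^ 2), by positivity,
    fun t ht h hh => ?_⟩
  obtain ⟨P, -, hP, hK⟩ := exists_mehler_add_eq m ht x
  have ht0 : 0 < t := ht.1
  have hτ0 := Real.tanh_pos ht0
  have hτ1 := Real.tanh_lt_one t
  have hexp : -(‖h‖ ^ 2 / 4 / t) + -(Real.tanh t * ⟪x, x + h⟫) ≤
      3 * ‖x‖ ^ 2 + (‖x‖ + 1) ^ 2 + (-‖x + h‖ ^ 2 / 2 - ‖x + h‖) + -(δ ^ 2 / 8 / t) := by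
    have h1 : δ ^ 2 / 8 / t + ‖h‖ ^ 2 ≤ ‖h‖ ^ 2 / 4 / t := by
      have h2 : ‖h‖ ^ 2 ≤ ‖h‖ ^ 2 / 8 / t := by
        rw [le_div_iff₀ ht0]; nlinarith [ht.2, sq_nonneg ‖h‖]
      have h3 : δ ^ 2 / 8 / t ≤ ‖h‖ ^ 2 / 8 / t := by gcongr
      have h4 : ‖h‖ ^ 2 / 4 / t = ‖h‖ ^ 2 / 8 / t + ‖h‖ ^ 2 / 8 / t := by ring
      linarith
    have h5 : -(Real.tanh t * ⟪x, x + h⟫) ≤ ‖x‖ * ‖x + h‖ := by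
      have := abs_real_inner_le_norm x (x + h)
      have := neg_abs_le ⟪x, x + h⟫
      nlinarith [abs_nonneg ⟪x, x + h⟫]
    have h6 : ‖x + h‖ ≤ ‖x‖ + ‖h‖ := norm_add_le x h
    have h7 : 3 / 4 * ‖x + h‖ ^ 2 ≤ ‖h‖ ^ 2 + 3 * ‖x‖ ^ 2 := by
      nlinarith [sq_nonneg (‖h‖ - 3 * ‖x‖), norm_nonneg (x + h), norm_nonneg x, norm_nonneg h]
    nlinarith [sq_nonneg (‖x + h‖ / 2 - (‖x‖ + 1))]
  rw [hK]
  calc _ ≤ Real.exp |m| * (t ^ (-(d : ℝ) / 2) * Real.exp (-(‖h‖ ^ 2 / 4 / t))) *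
        Real.exp (-(Real.tanh t * ⟪x, x + h⟫)) := by gcongr; exact (hP h).2
    _ = Real.exp |m| * t ^ (-(d : ℝ) / 2) *
        Real.exp (-(‖h‖ ^ 2 / 4 / t) + -(Real.tanh t * ⟪x, x + h⟫)) := by
        rw [Real.exp_add]; ring
    _ ≤ Real.exp |m| * t ^ (-(d : ℝ) / 2) *
        Real.exp (3 * ‖x‖ ^ 2 + (‖x‖ + 1) ^ 2 + (-‖x + h‖ ^ 2 / 2 - ‖x + h‖) +
          -(δ ^ 2 / 8 / t)) := by gcongr
    _ = _ := by rw [Real.exp_add, Real.exp_add]; ring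

theorem integrable_exp_neg_norm_sq_sub_norm :
    Integrable fun y : EuclideanSpace ℝ (Fin d) => Real.exp (-‖y‖ ^ 2 / 2 - ‖y‖) := by
  have hb : 0 < (1 / 2 : ℝ) := by norm_num
  have h : Integrable fun y : EuclideanSpace ℝ (Fin d) => Real.exp (-(1 / 2) * ‖y‖ ^ 2) := by
    refine Integrable.of_integral_ne_zero ?_
    rw [GaussianFourier.integral_rexp_neg_mul_sq_norm hb]
    positivity
  refine h.mono' (by fun_prop) (Eventually.of_forall fun y => ?_)
  rw [Real.norm_of_nonneg (by positivity), Real.exp_le_exp]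
  linarith [norm_nonneg y]

theorem integrable_mul_exp_neg_norm_sq_sub_norm (hσ : σ ∈ Ioo (0 : ℝ) 1)
    {f : EuclideanSpace ℝ (Fin d) → ℝ} (hf : Measurable f)
    (hint : Integrable fun y => |f y| * PhiSigma d m σ y) :
    Integrable fun y => f y * Real.exp (-‖y‖ ^ 2 / 2 - ‖y‖) := by
  obtain ⟨c, hc, hle⟩ := exists_mul_exp_le_PhiSigma (d := d) m hσ
  refine (hint.const_mul c⁻¹).mono' (by fun_prop) (Eventually.of_forall fun y => ?_)
  rw [norm_mul, Real.norm_of_nonneg (Real.exp_pos _).le, Real.norm_eq_abs, mul_left_comm]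
  gcongr
  rw [inv_mul_eq_div, le_div_iff₀ hc, mul_comm]
  exact hle y

theorem integrable_mehler_mul (m : ℝ) (ht : 0 < t) (x : EuclideanSpace ℝ (Fin d))
    {f : EuclideanSpace ℝ (Fin d) → ℝ} (hf : Measurable f)
    (hint : Integrable fun y => f y * Real.exp (-‖y‖ ^ 2 / 2 - ‖y‖)) :
    Integrable fun y => mehler d m t x y * f y := by
  obtain ⟨C, hC, hle⟩ := exists_mehler_le m ht x
  have hmeas : Measurable fun y => mehler d m t x y :=
    (measurable_mehler d m x).comp measurable_prodMk_left
  refine (hint.norm.const_mul C).mono' (hmeas.mul hf).aestronglyMeasurable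
    (Eventually.of_forall fun y => ?_)
  rw [norm_mul, norm_mul, Real.norm_of_nonneg (mehler_nonneg ht x y),
    Real.norm_of_nonneg (Real.exp_pos _).le, mul_left_comm, mul_comm]
  gcongr
  exact hle y

theorem measurable_integral_mehler_mul (m : ℝ) (x : EuclideanSpace ℝ (Fin d))
    {f : EuclideanSpace ℝ (Fin d) → ℝ} (hf : Measurable f) :
    Measurable fun t => ∫ y, mehler d m t x y * f y :=
  (StronglyMeasurable.integral_prod_right (f := fun t y => mehler d m t x y * f y)
    ((measurable_mehler d m x).mul (hf.comp measurable_snd)).stronglyMeasurable).measurable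

theorem integrableOn_Ioi_heat_sub (hm : -(d : ℝ) ≤ m) (hσ : σ ∈ Ioo (0 : ℝ) 1)
    {f : EuclideanSpace ℝ (Fin d) → ℝ} (hf : Measurable f)
    (hint : Integrable fun y => |f y| * PhiSigma d m σ y) (x : EuclideanSpace ℝ (Fin d)) :
    IntegrableOn (fun t => |(∫ y, mehler d m t x y * f y) - f x| * t ^ (-(1 + σ)))
      (Ioi (1 / 8 : ℝ)) := by
  obtain ⟨C, hC, hle⟩ := exists_lintegral_mehler_le hm hσ x
  have hprod := integrable_prod_kernel_mul (μ := volume.restrict (Ioi (1 / 8 : ℝ))) (ν := volume)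
    (K := fun t y => mehler d m t x y * t ^ (-(1 + σ))) (g := fun y => |f y|)
    (w := fun y => C * PhiSigma d m σ y)
    ((measurable_mehler d m x).mul (by fun_prop)) (by fun_prop)
    (Eventually.of_forall fun y _ => hle y)
    ((hint.const_mul C).congr (Eventually.of_forall fun y => by simp only; ring))
  have hpow : IntegrableOn (fun t : ℝ => t ^ (-(1 + σ))) (Ioi (1 / 8 : ℝ)) :=
    integrableOn_Ioi_rpow_of_lt (by linarith [hσ.1]) (by norm_num)
  refine (hprod.integral_prod_left.add (hpow.const_mul |f x|)).mono'
    (((measurable_integral_mehler_mul m x hf).sub_const _).abs.mul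
      (by fun_prop)).aestronglyMeasurable ?_
  filter_upwards [ae_restrict_mem measurableSet_Ioi] with t ht
  have ht0 : 0 < t := lt_trans (by norm_num) ht
  have hp : 0 ≤ t ^ (-(1 + σ)) := by positivity
  rw [norm_mul, Real.norm_of_nonneg hp, Real.norm_of_nonneg (abs_nonneg _)]
  have h1 : |∫ y, mehler d m t x y * f y| ≤ ∫ y, mehler d m t x y * |f y| := by
    refine (norm_integral_le_integral_norm fun y => mehler d m t x y * f y).trans_eq
      (integral_congr_ae (Eventually.of_forall fun y => ?_))
    simp only [norm_mul, Real.norm_eq_abs, abs_of_nonneg (mehler_nonneg ht0 x y)]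
  have h2 : ∫ y, mehler d m t x y * t ^ (-(1 + σ)) * |f y| =
      (∫ y, mehler d m t x y * |f y|) * t ^ (-(1 + σ)) := by
    rw [← integral_mul_const]
    exact integral_congr_ae (Eventually.of_forall fun y => by simp only; ring)
  simp only [Pi.add_apply]
  rw [h2, ← add_mul]
  gcongr
  exact (abs_sub _ _).trans (by gcongr)

theorem abs_setIntegral_closedBall_le {E : Type*} [NormedAddCommGroup E] [MeasurableSpace E]
    [BorelSpace E] {μ : Measure E} [μ.IsNegInvariant] {δ : ℝ} {φ ψ : E → ℝ}
    (hφ : IntegrableOn φ (Metric.closedBall 0 δ) μ) (hψ : IntegrableOn ψ (Metric.closedBall 0 δ) μ)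
    (hle : ∀ h, ‖h‖ ≤ δ → |φ h + φ (-h)| ≤ 2 * ψ h) :
    |∫ h in Metric.closedBall 0 δ, φ h ∂μ| ≤ ∫ h in Metric.closedBall 0 δ, ψ h ∂μ := by
  have hpre : (Neg.neg : E → E) ⁻¹' Metric.closedBall 0 δ = Metric.closedBall 0 δ := by
    ext h; simp
  have hmp := (Measure.measurePreserving_neg μ).restrict_preimage
    (Metric.isClosed_closedBall (x := (0 : E)) (ε := δ)).measurableSet
  rw [hpre] at hmp
  have hneg : ∫ h in Metric.closedBall 0 δ, φ (-h) ∂μ = ∫ h in Metric.closedBall 0 δ, φ h ∂μ :=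
    hmp.integral_comp (MeasurableEquiv.neg E).measurableEmbedding φ
  have hφ' : IntegrableOn (fun h => φ (-h)) (Metric.closedBall 0 δ) μ :=
    hmp.integrable_comp_of_integrable hφ
  have hsum : (∫ h in Metric.closedBall 0 δ, (φ h + φ (-h)) ∂μ) =
      2 * ∫ h in Metric.closedBall 0 δ, φ h ∂μ := by
    rw [integral_add hφ hφ', hneg]; ring
  have h := norm_integral_le_of_norm_le (f := fun h => φ h + φ (-h)) (hψ.const_mul 2) <|
    (ae_restrict_mem Metric.isClosed_closedBall.measurableSet).mono fun h hh =>
      hle h (mem_closedBall_zero_iff.1 hh)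
  rw [hsum, integral_const_mul, Real.norm_eq_abs, abs_mul, abs_two] at h
  linarith

/-- Integrability of the even part of the local contribution. -/
theorem integrable_gaussian_mul_of_integrable (hd : 1 ≤ d) (hσ : σ ∈ Ioo (0 : ℝ) 1)
    {ν : Measure (EuclideanSpace ℝ (Fin d))} [SFinite ν] {g : EuclideanSpace ℝ (Fin d) → ℝ}
    (hg : Measurable g) (hg0 : g 0 = 0)
    (hint : Integrable (fun h => g h / ‖h‖ ^ ((d : ℝ) + 2 * σ)) ν) :
    Integrable (fun p : ℝ × EuclideanSpace ℝ (Fin d) => p.1 ^ (-(d : ℝ) / 2) *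
      Real.exp (-(‖p.2‖ ^ 2 / 4 / p.1)) * p.1 ^ (-(1 + σ)) * g p.2)
      ((volume.restrict (Ioc (0 : ℝ) (1 / 8))).prod ν) := by
  have ha : 1 < (d : ℝ) / 2 + (1 + σ) := by
    have : (1 : ℝ) ≤ d := by exact_mod_cast hd
    linarith [hσ.1]
  set a := (d : ℝ) / 2 + (1 + σ)
  set C := Real.Gamma (a - 1) * (1 / 4) ^ (1 - a)
  refine integrable_prod_kernel_mul (K := fun t h => t ^ (-(d : ℝ) / 2) *
      Real.exp (-(‖h‖ ^ 2 / 4 / t)) * t ^ (-(1 + σ)))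
    (w := fun h => C * (‖h‖ ^ ((d : ℝ) + 2 * σ))⁻¹) ?_ hg
    (Eventually.of_forall fun h h0 => ?_)
    ((hint.const_mul C).congr (Eventually.of_forall fun h => by simp only; ring))
  · simp only [Function.uncurry_def]; fun_prop
  have hh : 0 < ‖h‖ := norm_pos_iff.2 fun e => h0 (e ▸ hg0)
  have hw : Real.Gamma (a - 1) * (‖h‖ ^ 2 / 4) ^ (1 - a) = C * (‖h‖ ^ ((d : ℝ) + 2 * σ))⁻¹ := by
    rw [div_eq_mul_one_div, Real.mul_rpow (by positivity) (by norm_num), ← Real.rpow_natCast,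
      ← Real.rpow_mul hh.le, ← Real.rpow_neg hh.le]
    have : ((2 : ℕ) : ℝ) * (1 - a) = -(d + 2 * σ) := by simp only [a]; push_cast; ring
    rw [this]; simp only [C]; ring
  rw [← hw, ← lintegral_rpow_neg_mul_exp_neg_div ha (by positivity)]
  refine (lintegral_mono_ae ?_).trans (lintegral_mono_set Ioc_subset_Ioi_self)
  filter_upwards [ae_restrict_mem measurableSet_Ioc] with t ht
  have ht0 : 0 < t := ht.1
  rw [Real.enorm_of_nonneg (by positivity)]
  refine (congrArg ENNReal.ofReal ?_).le
  have : -a = -(d : ℝ) / 2 + -(1 + σ) := by simp only [a]; ring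
  rw [this, Real.rpow_add ht0]; ring

/-- Integrability of the odd part of the local contribution. -/
theorem integrable_mul_norm_mul_gaussian_mul_of_integrable
    {ν : Measure (EuclideanSpace ℝ (Fin d))} [SFinite ν] {g : EuclideanSpace ℝ (Fin d) → ℝ}
    (hg : Measurable g) (hg0 : g 0 = 0)
    (hint : Integrable (fun h => g h / ‖h‖ ^ max ((d : ℝ) + 2 * σ - 3) 0) ν) :
    Integrable (fun p : ℝ × EuclideanSpace ℝ (Fin d) => p.1 * ‖p.2‖ * (p.1 ^ (-(d : ℝ) / 2) *
      Real.exp (-(‖p.2‖ ^ 2 / 4 / p.1))) * p.1 ^ (-(1 + σ)) * g p.2)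
      ((volume.restrict (Ioc (0 : ℝ) (1 / 8))).prod ν) := by
  set a := (d : ℝ) / 2 + σ with ha_def
  suffices hw : ∃ C : ℝ, ∀ h : EuclideanSpace ℝ (Fin d), 0 < ‖h‖ →
      ∫⁻ t in Ioc (0 : ℝ) (1 / 8), ENNReal.ofReal (‖h‖ * (t ^ (-a) *
        Real.exp (-(‖h‖ ^ 2 / 4 / t)))) ≤
        ENNReal.ofReal (C * (‖h‖ ^ max ((d : ℝ) + 2 * σ - 3) 0)⁻¹) by
    obtain ⟨C, hC⟩ := hw
    refine integrable_prod_kernel_mul (K := fun t h => t * ‖h‖ * (t ^ (-(d : ℝ) / 2) *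
        Real.exp (-(‖h‖ ^ 2 / 4 / t))) * t ^ (-(1 + σ)))
      (w := fun h => C * (‖h‖ ^ max ((d : ℝ) + 2 * σ - 3) 0)⁻¹) ?_ hg
      (Eventually.of_forall fun h h0 => ?_)
      ((hint.const_mul C).congr (Eventually.of_forall fun h => by simp only; ring))
    · simp only [Function.uncurry_def]; fun_prop
    refine le_trans (lintegral_mono_ae ?_) (hC h (norm_pos_iff.2 fun e => h0 (e ▸ hg0)))
    filter_upwards [ae_restrict_mem measurableSet_Ioc] with t ht
    have ht0 : 0 < t := ht.1
    rw [Real.enorm_of_nonneg (by positivity)]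
    refine (congrArg ENNReal.ofReal ?_).le
    have : -a = 1 + -(d : ℝ) / 2 + -(1 + σ) := by simp only [a]; ring
    rw [this, Real.rpow_add ht0, Real.rpow_add ht0, Real.rpow_one]; ring
  rcases le_or_gt 3 ((d : ℝ) + 2 * σ) with h3 | h3
  · refine ⟨Real.Gamma (a - 1) * (1 / 4) ^ (1 - a), fun h hh => ?_⟩
    have ha : 1 < a := by simp only [a]; linarith
    have hw : ‖h‖ * (Real.Gamma (a - 1) * (‖h‖ ^ 2 / 4) ^ (1 - a)) =
        Real.Gamma (a - 1) * (1 / 4) ^ (1 - a) * (‖h‖ ^ max ((d : ℝ) + 2 * σ - 3) 0)⁻¹ := by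
      rw [max_eq_left (by linarith), div_eq_mul_one_div, Real.mul_rpow (by positivity)
        (by norm_num), ← Real.rpow_natCast, ← Real.rpow_mul hh.le, ← Real.rpow_neg hh.le]
      have : -(d + 2 * σ - 3) = 1 + ((2 : ℕ) : ℝ) * (1 - a) := by simp only [a]; push_cast; ring
      rw [this, Real.rpow_add hh, Real.rpow_one]; ring
    rw [← hw, ENNReal.ofReal_mul hh.le, ← lintegral_rpow_neg_mul_exp_neg_div ha (by positivity),
      ← lintegral_const_mul _ (by fun_prop)]
    simp only [ENNReal.ofReal_mul hh.le]
    exact lintegral_mono_set Ioc_subset_Ioi_self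
  · have hpow : IntegrableOn (fun t : ℝ => t ^ (1 / 2 - a)) (Ioc 0 (1 / 8)) := by
      rw [← intervalIntegrable_iff_integrableOn_Ioc_of_le (by norm_num)]
      exact intervalIntegral.intervalIntegrable_rpow' (by simp only [a]; linarith)
    refine ⟨∫ t in Ioc (0 : ℝ) (1 / 8), t ^ (1 / 2 - a), fun h hh => ?_⟩
    rw [max_eq_right (by linarith), Real.rpow_zero, inv_one, mul_one,
      ofReal_integral_eq_lintegral_ofReal hpow]
    · refine lintegral_mono_ae ?_
      filter_upwards [ae_restrict_mem measurableSet_Ioc] with t ht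
      have ht0 : 0 < t := ht.1
      refine ENNReal.ofReal_le_ofReal ?_
      have hs := Real.sqrt_pos.2 ht0
      have h1 : ‖h‖ * Real.exp (-(‖h‖ ^ 2 / 4 / t)) ≤ √t := by
        rw [Real.exp_neg, ← div_eq_mul_inv, div_le_iff₀ (Real.exp_pos _)]
        have h2 := Real.add_one_le_exp (‖h‖ ^ 2 / 4 / t)
        have h3 : ‖h‖ ≤ √t * (‖h‖ ^ 2 / 4 / t + 1) := by
          have e : √t * (‖h‖ ^ 2 / 4 / t + 1) - ‖h‖ = √t * (‖h‖ / (2 * √t) - 1) ^ 2 := by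
            have := Real.sq_sqrt ht0.le
            rw [sub_sq, div_pow, mul_pow, this]
            field_simp
            ring
          have : 0 ≤ √t * (‖h‖ / (2 * √t) - 1) ^ 2 := by positivity
          linarith
        exact h3.trans (by gcongr)
      rw [sub_eq_add_neg, Real.rpow_add ht0, ← Real.sqrt_eq_rpow, mul_left_comm, mul_comm]
      gcongr
    · filter_upwards [ae_restrict_mem measurableSet_Ioc] with t ht
      have ht0 : 0 < t := ht.1
      positivity

theorem integrable_mehler_add_mul_of_far (hd : 1 ≤ d) (m : ℝ) (hσ : 0 < σ)
    (x : EuclideanSpace ℝ (Fin d)) {δ : ℝ} (hδ : 0 < δ)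
    {g : EuclideanSpace ℝ (Fin d) → ℝ} (hg : Measurable g)
    (hint : Integrable fun h => g h * Real.exp (-‖x + h‖ ^ 2 / 2 - ‖x + h‖)) :
    Integrable (fun p : ℝ × EuclideanSpace ℝ (Fin d) =>
      mehler d m p.1 x (x + p.2) * p.1 ^ (-(1 + σ)) * g p.2)
      ((volume.restrict (Ioc (0 : ℝ) (1 / 8))).prod
        (volume.restrict (Metric.closedBall 0 δ)ᶜ)) := by
  obtain ⟨C, hC, hle⟩ := exists_mehler_add_le_of_far m x hδ
  have ha : 1 < (d : ℝ) / 2 + (1 + σ) := by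
    have : (1 : ℝ) ≤ d := by exact_mod_cast hd
    linarith
  set a := (d : ℝ) / 2 + (1 + σ)
  set C' := Real.Gamma (a - 1) * (δ ^ 2 / 8) ^ (1 - a)
  set W : EuclideanSpace ℝ (Fin d) → ℝ := fun h => Real.exp (-‖x + h‖ ^ 2 / 2 - ‖x + h‖)
  refine integrable_prod_kernel_mul (K := fun t h => mehler d m t x (x + h) * t ^ (-(1 + σ)))
    (w := fun h => C * W h * C') ?_ hg ?_
    ((hint.integrableOn.const_mul (C * C')).congr
      (Eventually.of_forall fun h => by simp only [W]; ring))
  · exact ((measurable_mehler d m x).comp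
      (measurable_fst.prodMk (measurable_const.add measurable_snd))).mul (by fun_prop)
  filter_upwards [ae_restrict_mem Metric.isClosed_closedBall.measurableSet.compl] with h hh _
  have hh : δ ≤ ‖h‖ := by
    rw [mem_compl_iff, mem_closedBall_zero_iff, not_le] at hh
    exact hh.le
  have hCW : 0 ≤ C * W h := mul_nonneg hC (Real.exp_pos _).le
  rw [ENNReal.ofReal_mul hCW, ← lintegral_rpow_neg_mul_exp_neg_div ha (by positivity),
    ← lintegral_const_mul _ (by fun_prop)]
  refine (lintegral_mono_ae ?_).trans (lintegral_mono_set Ioc_subset_Ioi_self)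
  filter_upwards [ae_restrict_mem measurableSet_Ioc] with t ht
  have ht0 : 0 < t := ht.1
  have hK := mehler_nonneg (m := m) ht0 x (x + h)
  rw [Real.enorm_of_nonneg (by positivity), ← ENNReal.ofReal_mul hCW]
  refine ENNReal.ofReal_le_ofReal ?_
  have : -a = -(d : ℝ) / 2 + -(1 + σ) := by simp only [a]; ring
  calc _ ≤ C * W h * (t ^ (-(d : ℝ) / 2) * Real.exp (-(δ ^ 2 / 8 / t))) * t ^ (-(1 + σ)) := by
        gcongr; exact hle t ht h hh
    _ = _ := by rw [this, Real.rpow_add ht0]; ring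

theorem integrableOn_Ioc_heat_sub (hd : 1 ≤ d) (m : ℝ) (hσ : σ ∈ Ioo (0 : ℝ) 1)
    {f : EuclideanSpace ℝ (Fin d) → ℝ} (hf : Measurable f)
    (hint : Integrable fun y => f y * Real.exp (-‖y‖ ^ 2 / 2 - ‖y‖))
    (x : EuclideanSpace ℝ (Fin d)) (hsmooth : DalphaStAt d (2 * σ) f x) :
    IntegrableOn (fun t => |(∫ y, mehler d m t x y * f y) - f x| * t ^ (-(1 + σ)))
      (Ioc 0 (1 / 8 : ℝ)) := by
  obtain ⟨⟨δ₁, hδ₁, hS⟩, δ₂, hδ₂, hD⟩ := hsmooth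
  set δ := min δ₁ δ₂
  have hδ : 0 < δ := lt_min hδ₁ hδ₂
  set B : Set (EuclideanSpace ℝ (Fin d)) := Metric.closedBall 0 δ
  have hB : MeasurableSet B := Metric.isClosed_closedBall.measurableSet
  have hBle : ∀ h ∈ B, ‖h‖ ≤ δ := fun h hh => mem_closedBall_zero_iff.1 hh
  replace hS := hS.mono_set (s := B) fun h hh => (hBle h hh).trans (min_le_left _ _)
  replace hD := hD.mono_set (s := B) fun h hh => (hBle h hh).trans (min_le_right _ _)
  have hint1 : Integrable fun y => (f y - f x) * Real.exp (-‖y‖ ^ 2 / 2 - ‖y‖) := by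
    simp only [sub_mul]
    exact hint.sub (integrable_exp_neg_norm_sq_sub_norm.const_mul (f x))
  have hevenprod := integrable_gaussian_mul_of_integrable hd hσ (by fun_prop)
    (by simp only [add_zero, sub_zero, abs_eq_zero]; ring) hS
  have hoddprod := integrable_mul_norm_mul_gaussian_mul_of_integrable (by fun_prop)
    (by simp) hD
  have hfarprod := integrable_mehler_add_mul_of_far hd m hσ.1 x hδ
    (g := fun h => f (x + h) - f x) (by fun_prop) (hint1.comp_add_left x)
  obtain ⟨C₀, hC₀, hmass⟩ := exists_abs_integral_mehler_sub_one_le m x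
  obtain ⟨C₁, hC₁, hnear⟩ := exists_abs_mehler_add_add_le m x δ
  have hpow : IntegrableOn (fun t : ℝ => t ^ (-σ)) (Ioc 0 (1 / 8)) := by
    rw [← intervalIntegrable_iff_integrableOn_Ioc_of_le (by norm_num)]
    exact intervalIntegral.intervalIntegrable_rpow' (by linarith [hσ.2])
  refine ((((hevenprod.integral_prod_left.const_mul C₁).add
    (hoddprod.integral_prod_left.const_mul C₁)).add hfarprod.norm.integral_prod_left).add
    (hpow.const_mul (|f x| * C₀))).mono'
    (((measurable_integral_mehler_mul m x hf).sub_const _).abs.mul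
      (by fun_prop)).aestronglyMeasurable ?_
  filter_upwards [ae_restrict_mem measurableSet_Ioc, hevenprod.prod_right_ae,
    hoddprod.prod_right_ae] with t ht heven hodd
  have ht0 : 0 < t := ht.1
  set p := t ^ (-(1 + σ)) with hp_def
  have hp : 0 ≤ p := by positivity
  have hI1 := integrable_mehler_mul m ht0 x (hf.sub_const (f x)) hint1
  have hIK := integrable_mehler_mul m ht0 x (f := fun _ => 1) measurable_const
    (by simpa only [one_mul] using integrable_exp_neg_norm_sq_sub_norm)
  simp only [mul_one] at hIK
  set φ : EuclideanSpace ℝ (Fin d) → ℝ := fun h => mehler d m t x (x + h) * p * (f (x + h) - f x)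
  have hφ : Integrable φ := ((hI1.comp_add_left x).const_mul p).congr
    (Eventually.of_forall fun h => by simp only [φ]; ring)
  have hdecomp : ((∫ y, mehler d m t x y * f y) - f x) * p =
      (∫ h in B, φ h) + (∫ h in Bᶜ, φ h) + f x * ((∫ y, mehler d m t x y) - 1) * p := by
    have h1 : ∫ y, mehler d m t x y * f y =
        (∫ y, mehler d m t x y * (f y - f x)) + f x * ∫ y, mehler d m t x y := by
      rw [← integral_const_mul, ← integral_add hI1 (hIK.const_mul _)]
      exact integral_congr_ae (Eventually.of_forall fun y => by simp only; ring)
    have h2 : ∫ h, φ h = (∫ y, mehler d m t x y * (f y - f x)) * p := by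
      rw [← integral_add_left_eq_self (fun y => mehler d m t x y * (f y - f x)) x,
        ← integral_mul_const]
      exact integral_congr_ae (Eventually.of_forall fun y => by simp only [φ]; ring)
    rw [integral_add_compl hB hφ, h2, h1]
    ring
  have hnear' : |∫ h in B, φ h| ≤ _ :=
    abs_setIntegral_closedBall_le hφ.integrableOn ((heven.const_mul C₁).add (hodd.const_mul C₁))
      fun h hh => by
        obtain ⟨hadd, hsub⟩ := hnear t ht h hh
        have e : φ h + φ (-h) = p * (
            (mehler d m t x (x + h) + mehler d m t x (x - h)) *
              (f (x + h) + f (x - h) - 2 * f x) +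
            (mehler d m t x (x + h) - mehler d m t x (x - h)) * (f (x + h) - f (x - h))) / 2 := by
          simp only [φ, ← sub_eq_add_neg]
          ring
        have h1 := mul_le_mul_of_nonneg_right hadd (abs_nonneg (f (x + h) + f (x - h) - 2 * f x))
        have h2 := mul_le_mul_of_nonneg_right hsub (abs_nonneg (f (x + h) - f (x - h)))
        rw [← abs_mul] at h1 h2
        have h3 := mul_le_mul_of_nonneg_left ((abs_add_le _ _).trans (add_le_add h1 h2)) hp
        rw [e, abs_div, abs_mul, abs_of_nonneg hp, abs_two]
        have h4 := (mul_nonneg hp (abs_nonneg _)).trans h3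
        simp only [Pi.add_apply]
        linarith
  have hfar' : |∫ h in Bᶜ, φ h| ≤ ∫ h in Bᶜ, ‖φ h‖ := norm_integral_le_integral_norm φ
  have hmass' : |f x * ((∫ y, mehler d m t x y) - 1) * p| ≤ |f x| * C₀ * t ^ (-σ) := by
    have e : t * p = t ^ (-σ) := by
      rw [hp_def, neg_add, Real.rpow_add ht0, Real.rpow_neg_one, mul_inv_cancel_left₀ ht0.ne']
    rw [abs_mul, abs_mul, abs_of_nonneg hp, ← e]
    calc _ ≤ |f x| * (C₀ * t) * p := by gcongr; exact hmass t ht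
      _ = _ := by ring
  rw [integral_add' (heven.const_mul C₁) (hodd.const_mul C₁), integral_const_mul,
    integral_const_mul] at hnear'
  rw [Real.norm_of_nonneg (by positivity), ← abs_of_nonneg hp, ← abs_mul, hdecomp]
  simp only [Pi.add_apply]
  exact (abs_add_le _ _).trans (add_le_add
    ((abs_add_le _ _).trans (add_le_add hnear' hfar')) hmass')

end MehlerKernel

/-- For the Hermite-type operator `L = -Δ + |x|² + m` with `d ≥ 1`,
`m ≥ -d`, `σ ∈ (0,1)`: if `f ∈ L¹(Φ_σ)` is measurable and strictly `2σ`-smooth at `x₀`,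
then `∫₀^∞ |e^{-tL}f(x₀) - f(x₀)| t^{-(1+σ)} dt < ∞`, i.e. the Bochner-type integral
defining `L^σ f(x₀)` converges absolutely. -/
theorem hermite_fractional_power_absolutely_convergent
    (d : ℕ) (hd : 1 ≤ d) (m : ℝ) (hm : -(d : ℝ) ≤ m)
    (σ : ℝ) (hσ : σ ∈ Set.Ioo (0 : ℝ) 1)
    (f : EuclideanSpace ℝ (Fin d) → ℝ) (hfmeas : Measurable f)
    (hfint : MeasureTheory.Integrable (fun y => |f y| * PhiSigma d m σ y))
    (x₀ : EuclideanSpace ℝ (Fin d))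
    (hsmooth : DalphaStAt d (2 * σ) f x₀) :
    MeasureTheory.IntegrableOn
      (fun t => |(∫ y, mehler d m t x₀ y * f y) - f x₀| * t ^ (-(1 + σ)))
      (Set.Ioi (0 : ℝ)) := by
  rw [← Ioc_union_Ioi_eq_Ioi (by norm_num : (0 : ℝ) ≤ 1 / 8)]
  exact (integrableOn_Ioc_heat_sub hd m hσ hfmeas
    (integrable_mul_exp_neg_norm_sq_sub_norm hσ hfmeas hfint) x₀ hsmooth).union
    (integrableOn_Ioi_heat_sub hm hσ hfmeas hfint x₀)
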